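/- arXiv:1610.00531 — 2 statements merged into one kernel-verified Lean document; each statement's English description precedes it below -/
import Mathlib

section
/- Let q, λ, μ ∈ ℂ with q nonzero and not a root of unity, λ ≠ 0, μ ≠ 0, and suppose (μ;q)_t ≠ 0 and (μ;q)_s ≠ 0. Define f(s,t;λ,μ) = Σ_{i=0}^{t} q^{s·i} (μ/λ)^i (λ;q)_i (μ/λ;q)_{t−i} binom(t,i)_q / (μ;q)_t for s,t ∈ ℕ. Then f(s,t;λ,μ) = f(t,s;λ,μ) for all s,t ∈ ℕ. -/
/-- The q-Pochhammer symbol `(z;q)_m = ∏_{j=0}^{m-1} (1 - z q^j)`. -/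
noncomputable def qPoch (q z : ℂ) (m : ℕ) : ℂ := ∏ j ∈ Finset.range m, (1 - z * q ^ j)

/-- The q-binomial coefficient `binom(m,k)_q`. -/
noncomputable def qBinom (q : ℂ) (m k : ℕ) : ℂ :=
  if k ≤ m then qPoch q q m / (qPoch q q k * qPoch q q (m - k)) else 0

/-- `q` is not a root of unity. -/
def notRootOfUnity (q : ℂ) : Prop := ∀ m : ℕ, 0 < m → q ^ m ≠ 1

/-- `f(s,t;λ,μ) = Σ_{i=0}^{t} q^{s i} (μ/λ)^i (λ;q)_i (μ/λ;q)_{t−i} binom(t,i)_q / (μ;q)_t`. -/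
noncomputable def f (q lam mu : ℂ) (s t : ℕ) : ℂ :=
  ∑ i ∈ Finset.range (t + 1),
    q ^ (s * i) * (mu / lam) ^ i * qPoch q lam i * qPoch q (mu / lam) (t - i) *
      qBinom q t i / qPoch q mu t

open PowerSeries in
/-- The q-binomial series `∑ (c;q)_n / (q;q)_n Xⁿ`, formally `(cX;q)_∞ / (X;q)_∞`. -/
noncomputable def qBinomialSeries (q c : ℂ) : ℂ⟦X⟧ :=
  PowerSeries.mk fun n => qPoch q c n / qPoch q q n

lemma qPoch_zero (q z : ℂ) : qPoch q z 0 = 1 := by simp [qPoch]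

lemma qPoch_succ (q z : ℂ) (m : ℕ) : qPoch q z (m + 1) = qPoch q z m * (1 - z * q ^ m) := by
  simp [qPoch, Finset.prod_range_succ]

lemma qPoch_add (q z : ℂ) (m n : ℕ) :
    qPoch q z (m + n) = qPoch q z m * qPoch q (z * q ^ m) n := by
  simp only [qPoch, Finset.prod_range_add, pow_add, mul_assoc]

lemma notRootOfUnity.one_sub_ne_zero {q : ℂ} (hq : notRootOfUnity q) (m : ℕ) :
    1 - q ^ m * q ≠ 0 := by
  rw [← pow_succ, sub_ne_zero]
  exact (hq (m + 1) m.succ_pos).symm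

lemma notRootOfUnity.one_sub_ne_zero' {q : ℂ} (hq : notRootOfUnity q) (m : ℕ) :
    1 - q * q ^ m ≠ 0 :=
  mul_comm q (q ^ m) ▸ hq.one_sub_ne_zero m

lemma notRootOfUnity.qPoch_ne_zero {q : ℂ} (hq : notRootOfUnity q) (m : ℕ) :
    qPoch q q m ≠ 0 :=
  Finset.prod_ne_zero_iff.2 fun j _ => hq.one_sub_ne_zero' j

namespace PowerSeries

lemma coeff_zero_one_sub_C_mul_X_mul (c : ℂ) (F : ℂ⟦X⟧) :
    coeff 0 ((1 - C c * X) * F) = coeff 0 F := by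
  simp

lemma coeff_succ_one_sub_C_mul_X_mul (c : ℂ) (F : ℂ⟦X⟧) (n : ℕ) :
    coeff (n + 1) ((1 - C c * X) * F) = coeff (n + 1) F - c * coeff n F := by
  rw [sub_mul, one_mul, mul_assoc, map_sub, coeff_C_mul, coeff_succ_X_mul]

lemma one_sub_C_mul_X_ne_zero (c : ℂ) : (1 - C c * X : ℂ⟦X⟧) ≠ 0 := fun h => by
  simpa using congrArg (coeff 0) h

lemma rescale_one_sub_C_mul_X (b c : ℂ) :
    rescale b (1 - C c * X : ℂ⟦X⟧) = 1 - C (c * b) * X := by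
  have hC : rescale b (C c : ℂ⟦X⟧) = C c := by
    ext n
    cases n <;> simp [coeff_C]
  rw [map_sub, map_one, map_mul, hC, rescale_X, map_mul, mul_assoc]

end PowerSeries

open PowerSeries

lemma qBinomialSeries_qDiff {q : ℂ} (hq : notRootOfUnity q) (c : ℂ) :
    (1 - X) * qBinomialSeries q c = (1 - C c * X) * rescale q (qBinomialSeries q c) := by
  have h1 : (1 - X : ℂ⟦X⟧) = 1 - C 1 * X := by simp
  rw [h1]
  ext n
  cases n with
  | zero => simp only [coeff_zero_one_sub_C_mul_X_mul, coeff_rescale, pow_zero, one_mul]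
  | succ n =>
    have := hq.qPoch_ne_zero n
    have := hq.one_sub_ne_zero n
    simp only [coeff_succ_one_sub_C_mul_X_mul, coeff_rescale, qBinomialSeries, coeff_mk,
      qPoch_succ]
    field_simp
    ring

lemma eq_qBinomialSeries_of_qDiff {q : ℂ} (hq : notRootOfUnity q) {c : ℂ} {F : ℂ⟦X⟧}
    (h0 : coeff 0 F = 1) (h : (1 - X) * F = (1 - C c * X) * rescale q F) :
    F = qBinomialSeries q c := by
  have h1 : (1 - X : ℂ⟦X⟧) = 1 - C 1 * X := by simp
  rw [h1] at h
  ext n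
  induction n with
  | zero => rw [h0]; simp [qBinomialSeries, qPoch_zero]
  | succ n ih =>
    have hn := congrArg (coeff (n + 1)) h
    simp only [coeff_succ_one_sub_C_mul_X_mul, coeff_rescale] at hn
    have := hq.qPoch_ne_zero n
    have h2 := hq.one_sub_ne_zero n
    have h3 : (1 - q ^ n * q) * coeff (n + 1) F = (1 - c * q ^ n) * coeff n F := by
      linear_combination hn
    rw [← mul_right_inj' h2, h3, ih]
    simp only [qBinomialSeries, coeff_mk, qPoch_succ]
    field_simp

lemma rescale_qBinomialSeries_mul {q : ℂ} (hq : notRootOfUnity q) (a b : ℂ) :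
    rescale b (qBinomialSeries q a) * qBinomialSeries q b = qBinomialSeries q (a * b) := by
  apply eq_qBinomialSeries_of_qDiff hq
  · simp [qBinomialSeries, coeff_mul, qPoch_zero]
  · have h1 := congrArg (rescale b) (qBinomialSeries_qDiff hq a)
    have hX : (1 - X : ℂ⟦X⟧) = 1 - C 1 * X := by simp
    have h2 := qBinomialSeries_qDiff hq b
    rw [hX, map_mul, map_mul, rescale_one_sub_C_mul_X, rescale_one_sub_C_mul_X, one_mul,
      rescale_rescale, mul_comm q b] at h1
    apply mul_left_cancel₀ (one_sub_C_mul_X_ne_zero b)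
    rw [map_mul (rescale q), rescale_rescale]
    linear_combination (1 - X) * qBinomialSeries q b * h1 +
      (1 - C (a * b) * X) * rescale (b * q) (qBinomialSeries q a) * h2

lemma qBinomialSeries_eq_one_sub_mul {q : ℂ} (hq : notRootOfUnity q) (c : ℂ) :
    qBinomialSeries q c = (1 - C c * X) * qBinomialSeries q (c * q) := by
  ext n
  cases n with
  | zero => simp [qBinomialSeries, qPoch_zero]
  | succ n =>
    have := hq.qPoch_ne_zero n
    have := hq.one_sub_ne_zero' n
    have h : qPoch q c (n + 1) = (1 - c) * qPoch q (c * q) n := by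
      rw [add_comm, qPoch_add]
      simp [qPoch]
    rw [coeff_succ_one_sub_C_mul_X_mul]
    simp only [qBinomialSeries, coeff_mk, h]
    simp only [qPoch_succ]
    field_simp
    ring

/-- The polynomial `(bX;q)_s` as a power series. -/
noncomputable def qPochSeries (q b : ℂ) (s : ℕ) : ℂ⟦X⟧ :=
  ∏ j ∈ Finset.range s, (1 - C (b * q ^ j) * X)

lemma rescale_mul_eq_qPochSeries_mul {q : ℂ} (hq : notRootOfUnity q) (a b : ℂ) (s : ℕ) :
    rescale (b * q ^ s) (qBinomialSeries q a) * qBinomialSeries q b =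
      qPochSeries q b s * qBinomialSeries q (a * b * q ^ s) := by
  induction s with
  | zero => simpa [qPochSeries] using rescale_qBinomialSeries_mul hq a b
  | succ s ih =>
    have h1 := congrArg (rescale (b * q ^ s)) (qBinomialSeries_qDiff hq a)
    have hX : (1 - X : ℂ⟦X⟧) = 1 - C 1 * X := by simp
    rw [hX, map_mul, map_mul, rescale_one_sub_C_mul_X, rescale_one_sub_C_mul_X, one_mul,
      rescale_rescale] at h1
    have h2 := qBinomialSeries_eq_one_sub_mul hq (a * b * q ^ s)
    have e1 : b * q ^ (s + 1) = q * (b * q ^ s) := by ring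
    have e2 : a * b * q ^ (s + 1) = a * b * q ^ s * q := by ring
    have e3 : a * (b * q ^ s) = a * b * q ^ s := by ring
    rw [e3] at h1
    apply mul_left_cancel₀ (one_sub_C_mul_X_ne_zero (a * b * q ^ s))
    rw [e1, e2, qPochSeries, Finset.prod_range_succ, ← qPochSeries]
    rw [mul_comm q (b * q ^ s)] at h1 ⊢
    linear_combination (-qBinomialSeries q b) * h1 + (1 - C (b * q ^ s) * X) * ih +
      (1 - C (b * q ^ s) * X) * qPochSeries q b s * h2

lemma qBinom_zero_right {q : ℂ} (hq : notRootOfUnity q) (m : ℕ) : qBinom q m 0 = 1 := by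
  simp [qBinom, qPoch_zero, hq.qPoch_ne_zero m]

lemma qBinom_succ_succ_mul_pow {q : ℂ} (hq : notRootOfUnity q) (m k : ℕ) :
    q ^ k * qBinom q (m + 1) (k + 1) = q ^ k * qBinom q m (k + 1) + q ^ m * qBinom q m k := by
  rcases lt_trichotomy k m with h | rfl | h
  · obtain ⟨d, rfl⟩ := Nat.exists_eq_add_of_lt h
    have := hq.qPoch_ne_zero k
    have := hq.qPoch_ne_zero d
    have := hq.one_sub_ne_zero k
    have := hq.one_sub_ne_zero' d
    have e1 : k + d + 1 + 1 - (k + 1) = d + 1 := by omega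
    have e2 : k + d + 1 - (k + 1) = d := by omega
    have e3 : k + d + 1 - k = d + 1 := by omega
    rw [qBinom, qBinom, qBinom, if_pos (by omega), if_pos (by omega), if_pos (by omega),
      e1, e2, e3, qPoch_succ q q (k + d + 1), qPoch_succ q q d, qPoch_succ q q k]
    field_simp
    ring
  · have := hq.qPoch_ne_zero k
    have := hq.qPoch_ne_zero (k + 1)
    simp [qBinom, qPoch_zero, *]
  · simp [qBinom, show ¬ k ≤ m by omega, show ¬ k + 1 ≤ m by omega]

lemma coeff_qPochSeries {q : ℂ} (hq : notRootOfUnity q) (b : ℂ) (s k : ℕ) :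
    coeff k (qPochSeries q b s) = (-b) ^ k * q ^ (∑ j ∈ Finset.range k, j) * qBinom q s k := by
  induction s generalizing k with
  | zero =>
    cases k with
    | zero => simp [qPochSeries, qBinom_zero_right hq]
    | succ k => simp [qPochSeries, qBinom, coeff_one]
  | succ s ih =>
    rw [qPochSeries, Finset.prod_range_succ, ← qPochSeries, mul_comm]
    cases k with
    | zero => rw [coeff_zero_one_sub_C_mul_X_mul, ih]; simp [qBinom_zero_right hq]
    | succ k =>
      rw [coeff_succ_one_sub_C_mul_X_mul, ih, ih, Finset.sum_range_succ, pow_add, pow_succ (-b)]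
      linear_combination (-(-b) ^ k * -b * q ^ (∑ j ∈ Finset.range k, j)) *
        qBinom_succ_succ_mul_pow hq s k

lemma f_mul_qPoch_eq_coeff {q : ℂ} (hq : notRootOfUnity q) (lam mu : ℂ) (s t : ℕ)
    (ht : qPoch q mu t ≠ 0) :
    f q lam mu s t * qPoch q mu t = qPoch q q t * coeff t
      (rescale (mu / lam * q ^ s) (qBinomialSeries q lam) * qBinomialSeries q (mu / lam)) := by
  rw [coeff_mul, Finset.Nat.sum_antidiagonal_eq_sum_range_succ_mk, f, Finset.sum_mul,
    Finset.mul_sum]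
  refine Finset.sum_congr rfl fun i hi => ?_
  have hi' : i ≤ t := Nat.lt_succ_iff.1 (Finset.mem_range.1 hi)
  simp only [coeff_rescale, qBinomialSeries, coeff_mk, qBinom, if_pos hi', div_mul_cancel₀ _ ht,
    mul_pow, ← pow_mul]
  have := hq.qPoch_ne_zero i
  have := hq.qPoch_ne_zero (t - i)
  field_simp

/-- The normalised sum `f` in a form that is symmetric in `s` and `t`. -/
lemma f_mul_qPoch_mul_qPoch {q : ℂ} (hq : notRootOfUnity q) {lam : ℂ} (hlam : lam ≠ 0) (mu : ℂ)
    (s t : ℕ) (ht : qPoch q mu t ≠ 0) :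
    f q lam mu s t * qPoch q mu t * qPoch q mu s =
      ∑ k ∈ Finset.range (s + t + 1), (-(mu / lam)) ^ k * q ^ (∑ j ∈ Finset.range k, j) *
        (qBinom q s k * qBinom q t k) * qPoch q q k * qPoch q mu (s + t - k) := by
  have hsub : Finset.range (t + 1) ⊆ Finset.range (s + t + 1) := by
    intro k hk
    rw [Finset.mem_range] at hk ⊢
    omega
  rw [f_mul_qPoch_eq_coeff hq lam mu s t ht, rescale_mul_eq_qPochSeries_mul hq,
    mul_div_cancel₀ _ hlam, coeff_mul, Finset.Nat.sum_antidiagonal_eq_sum_range_succ_mk,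
    Finset.mul_sum, Finset.sum_mul]
  rw [← Finset.sum_subset hsub]
  · refine Finset.sum_congr rfl fun k hk => ?_
    have hk' : k ≤ t := Nat.lt_succ_iff.1 (Finset.mem_range.1 hk)
    have := hq.qPoch_ne_zero k
    have := hq.qPoch_ne_zero (t - k)
    have hB : qBinom q t k = qPoch q q t / (qPoch q q k * qPoch q q (t - k)) := if_pos hk'
    rw [coeff_qPochSeries hq, Nat.add_sub_assoc hk', qPoch_add, hB, qBinomialSeries, coeff_mk]
    field_simp
  · intro k _ hk
    have hk' : ¬ k ≤ t := fun h => hk (Finset.mem_range.2 (Nat.lt_succ_of_le h))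
    simp [qBinom, hk']

theorem f_symm (q lam mu : ℂ) (hq0 : q ≠ 0) (hq : notRootOfUnity q)
    (hlam : lam ≠ 0) (hmu : mu ≠ 0) (s t : ℕ)
    (ht : qPoch q mu t ≠ 0) (hs : qPoch q mu s ≠ 0) :
    f q lam mu s t = f q lam mu t s := by
  apply mul_right_cancel₀ (mul_ne_zero ht hs)
  rw [← mul_assoc, f_mul_qPoch_mul_qPoch hq hlam mu s t ht, mul_comm (qPoch q mu t), ← mul_assoc,
    f_mul_qPoch_mul_qPoch hq hlam mu t s hs, add_comm t s]
  exact Finset.sum_congr rfl fun k _ => by rw [mul_comm (qBinom q t k)]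
end

section
/- Let n ≥ 1 and let q, λ, μ ∈ ℝ satisfy 0 < q < 1 and 0 < μ < λ < 1. Then for all γ, β ∈ ℤ_{≥0}^n, Φ_q^{(n)}(γ|β;λ,μ) ≥ 0. -/
/-- The real q-Pochhammer symbol `(z;q)_m = ∏_{j=0}^{m-1} (1 - z q^j)`. -/
noncomputable def qPochR (q z : ℝ) (m : ℕ) : ℝ := ∏ j ∈ Finset.range m, (1 - z * q ^ j)

/-- The real q-binomial coefficient `binom(m,k)_q`. -/
noncomputable def qBinomR (q : ℝ) (m k : ℕ) : ℝ :=
  if k ≤ m then qPochR q q m / (qPochR q q k * qPochR q q (m - k)) else 0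

/-- `φ(β,γ) = Σ_{1 ≤ i < j ≤ k} β_i γ_j` for integer vectors. -/
def phi {k : ℕ} (β γ : Fin k → ℤ) : ℤ :=
  ∑ i, ∑ j, if i < j then β i * γ j else 0

open Classical in
/-- The real weight `Φ_q^{(n)}(γ|β;λ,μ)` of the stochastic R matrix of `U_q(A^{(1)}_n)`. -/
noncomputable def PhiR (n : ℕ) (q lam mu : ℝ) (γ β : Fin n → ℕ) : ℝ :=
  if γ ≤ β then
    q ^ phi (fun i => (β i : ℤ) - (γ i : ℤ)) (fun i => (γ i : ℤ))
      * (mu / lam) ^ (∑ i, γ i)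
      * qPochR q lam (∑ i, γ i) * qPochR q (mu / lam) ((∑ i, β i) - ∑ i, γ i)
      * (∏ i, qBinomR q (β i) (γ i)) / qPochR q mu (∑ i, β i)
  else 0

/-- The q-Pochhammer symbol `(z;q)_m` is nonnegative for `0 ≤ q ≤ 1` and `z ≤ 1`. -/
theorem qPochR_nonneg {q z : ℝ} (hq0 : 0 ≤ q) (hq1 : q ≤ 1) (hz1 : z ≤ 1) (m : ℕ) :
    0 ≤ qPochR q z m :=
  Finset.prod_nonneg fun j _ => by
    have h0 : 0 ≤ q ^ j := pow_nonneg hq0 j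
    have h1 : q ^ j ≤ 1 := pow_le_one₀ hq0 hq1
    nlinarith

/-- The q-binomial coefficient is nonnegative for `0 ≤ q ≤ 1`. -/
theorem qBinomR_nonneg {q : ℝ} (hq0 : 0 ≤ q) (hq1 : q ≤ 1) (m k : ℕ) :
    0 ≤ qBinomR q m k := by
  have h := qPochR_nonneg hq0 hq1 hq1
  unfold qBinomR
  split_ifs
  · exact div_nonneg (h _) (mul_nonneg (h _) (h _))
  · exact le_rfl

/-- Nonnegativity of the stochastic R matrix weights for `0 < q < 1`, `0 < μ < λ < 1`. -/
theorem PhiR_nonneg (n : ℕ) (hn : 1 ≤ n) (q lam mu : ℝ)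
    (hq0 : 0 < q) (hq1 : q < 1) (hmu0 : 0 < mu) (hml : mu < lam) (hl1 : lam < 1)
    (γ β : Fin n → ℕ) : 0 ≤ PhiR n q lam mu γ β := by
  have hlam : 0 < lam := hmu0.trans hml
  have hratio : mu / lam ≤ 1 := (div_le_one hlam).2 hml.le
  have hpoch {z : ℝ} (hz : z ≤ 1) (m : ℕ) : 0 ≤ qPochR q z m :=
    qPochR_nonneg hq0.le hq1.le hz m
  have hbinom : 0 ≤ ∏ i, qBinomR q (β i) (γ i) :=
    Finset.prod_nonneg fun i _ => qBinomR_nonneg hq0.le hq1.le _ _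
  have hpow : 0 ≤ (mu / lam) ^ ∑ i, γ i := pow_nonneg (div_pos hmu0 hlam).le _
  unfold PhiR
  split_ifs
  · exact div_nonneg (mul_nonneg (mul_nonneg (mul_nonneg (mul_nonneg (zpow_nonneg hq0.le _) hpow)
      (hpoch hl1.le _)) (hpoch hratio _)) hbinom) (hpoch (hml.trans hl1).le _)
  · exact le_rfl
end
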